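/- Let B be a linear operator on functions ℤ² → ℝ for which there is a finite set Ω_inc ⊂ ℤ² such that Bu is supported in Ω_inc for every u. Let v : ℤ² → ℝ satisfy Av = 0, and let w : ℤ² → ℝ satisfy (A + B)w = −Bv together with w(m) → 0 as |m| → ∞. Then μ := Bw satisfies the reduced equation μ + B(Sμ) = −B(S(Bv)) on ℤ², and the solution u := v + w of (A + B)u = 0 is recovered as u = v − S(Bv + μ). -/

import Mathlib

open Real MeasureTheory Filter

/-- The integrand of the lattice fundamental solution. -/
noncomputable def latticeKernel (m : ℤ × ℤ) (t : ℝ × ℝ) : ℝ :=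
  (Real.cos (t.1 * (m.1 : ℝ) + t.2 * (m.2 : ℝ)) - 1) /
    (4 * Real.sin (t.1 / 2) ^ 2 + 4 * Real.sin (t.2 / 2) ^ 2)

/-- The lattice fundamental solution `φ`. -/
noncomputable def phi (m : ℤ × ℤ) : ℝ :=
  (1 / (2 * Real.pi) ^ 2) *
    ∫ t in Set.Icc (-Real.pi) Real.pi ×ˢ Set.Icc (-Real.pi) Real.pi, latticeKernel m t

/-- The discrete Laplace operator on `ℤ²`. -/
noncomputable def discLap (u : ℤ × ℤ → ℝ) (m : ℤ × ℤ) : ℝ :=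
  4 * u m - u (m + (1, 0)) - u (m - (1, 0)) - u (m + (0, 1)) - u (m - (0, 1))

/-- The Euclidean norm `|m| = √(m₁² + m₂²)` of a lattice point. -/
noncomputable def latNorm (m : ℤ × ℤ) : ℝ :=
  Real.sqrt ((m.1 : ℝ) ^ 2 + (m.2 : ℝ) ^ 2)

/-- Convolution with the lattice fundamental solution: `[Sf](m) = Σₙ φ(m−n) f(n)`. -/
noncomputable def latConv (f : ℤ × ℤ → ℝ) (m : ℤ × ℤ) : ℝ :=
  ∑ᶠ n : ℤ × ℤ, phi (m - n) * f n

/-- The average of a function over the four nearest neighbours of a lattice point. -/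
noncomputable def latAvg (u : ℤ × ℤ → ℝ) (m : ℤ × ℤ) : ℝ :=
  (u (m + (1, 0)) + u (m - (1, 0)) + u (m + (0, 1)) + u (m - (0, 1))) / 4

/-- The Fourier symbol of `latAvg`. -/
noncomputable def avgSymbol (t : ℝ × ℝ) : ℝ := (Real.cos t.1 + Real.cos t.2) / 2

/-- The square `[-π, π]²`. -/
noncomputable def brillouin : Set (ℝ × ℝ) :=
  Set.Icc (-Real.pi) Real.pi ×ˢ Set.Icc (-Real.pi) Real.pi

/-- The `k`-step transition probability of the simple random walk on `ℤ²`, as a Fourier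
integral. -/
noncomputable def walkKernel (k : ℕ) (m : ℤ × ℤ) : ℝ :=
  (1 / (2 * Real.pi) ^ 2) *
    ∫ t in brillouin, Real.cos (t.1 * (m.1 : ℝ) + t.2 * (m.2 : ℝ)) * avgSymbol t ^ k

lemma discLap_eq_sub_latAvg (u : ℤ × ℤ → ℝ) (m : ℤ × ℤ) :
    discLap u m = 4 * (u m - latAvg u m) := by
  unfold discLap latAvg; ring

lemma abs_sin_int_mul_le (n : ℤ) (x : ℝ) : |Real.sin (n * x)| ≤ |(n : ℝ)| * |Real.sin x| := by
  have h : ∀ k : ℕ, |Real.sin (k * x)| ≤ k * |Real.sin x| := by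
    intro k
    induction k with
    | zero => simp
    | succ k ih =>
      push_cast
      rw [add_mul, one_mul, Real.sin_add, add_mul, one_mul]
      refine (abs_add_le _ _).trans ?_
      rw [abs_mul, abs_mul]
      have h1 := Real.abs_cos_le_one x
      have h2 := Real.abs_cos_le_one (k * x)
      have h3 := abs_nonneg (Real.sin x)
      have h4 := abs_nonneg (Real.sin (k * x))
      nlinarith
  obtain ⟨k, rfl | rfl⟩ := n.eq_nat_or_neg
  · simpa using h k
  · simpa using h k

lemma one_sub_cos_le (m : ℤ × ℤ) (t : ℝ × ℝ) :
    1 - Real.cos (t.1 * m.1 + t.2 * m.2) ≤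
      ((m.1 : ℝ) ^ 2 + (m.2 : ℝ) ^ 2) *
        (4 * Real.sin (t.1 / 2) ^ 2 + 4 * Real.sin (t.2 / 2) ^ 2) := by
  have h1 := abs_sin_int_mul_le m.1 (t.1 / 2)
  have h2 := abs_sin_int_mul_le m.2 (t.2 / 2)
  have e : 1 - Real.cos (t.1 * m.1 + t.2 * m.2) =
      2 * Real.sin (m.1 * (t.1 / 2) + m.2 * (t.2 / 2)) ^ 2 := by
    rw [Real.sin_sq_eq_half_sub]; ring_nf
  have h3 : |Real.sin (m.1 * (t.1 / 2) + m.2 * (t.2 / 2))| ≤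
      |(m.1 : ℝ)| * |Real.sin (t.1 / 2)| + |(m.2 : ℝ)| * |Real.sin (t.2 / 2)| := by
    rw [Real.sin_add]
    refine (abs_add_le _ _).trans ?_
    rw [abs_mul, abs_mul]
    refine add_le_add ?_ ?_
    · exact (mul_le_of_le_one_right (abs_nonneg _) (Real.abs_cos_le_one _)).trans h1
    · exact (mul_le_of_le_one_left (abs_nonneg _) (Real.abs_cos_le_one _)).trans h2
  rw [e, ← sq_abs, ← sq_abs (m.1 : ℝ), ← sq_abs (m.2 : ℝ), ← sq_abs (Real.sin (t.1 / 2)),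
    ← sq_abs (Real.sin (t.2 / 2))]
  generalize |(m.1 : ℝ)| = a at *
  generalize |(m.2 : ℝ)| = b at *
  generalize |Real.sin (t.1 / 2)| = x at *
  generalize |Real.sin (t.2 / 2)| = y at *
  have h4 := pow_le_pow_left₀ (abs_nonneg _) h3 2
  nlinarith [sq_nonneg (a * x - b * y), sq_nonneg (a * y), sq_nonneg (b * x),
    sq_nonneg (a * x), sq_nonneg (b * y)]

lemma sin_half_sq_add_eq (t : ℝ × ℝ) :
    4 * Real.sin (t.1 / 2) ^ 2 + 4 * Real.sin (t.2 / 2) ^ 2 = 4 * (1 - avgSymbol t) := by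
  rw [Real.sin_sq_eq_half_sub, Real.sin_sq_eq_half_sub, avgSymbol]; ring_nf

lemma abs_avgSymbol_le_one (t : ℝ × ℝ) : |avgSymbol t| ≤ 1 := by
  unfold avgSymbol
  rw [abs_le]
  constructor <;> linarith [Real.cos_le_one t.1, Real.cos_le_one t.2, Real.neg_one_le_cos t.1,
    Real.neg_one_le_cos t.2]

lemma abs_latticeKernel_le (m : ℤ × ℤ) (t : ℝ × ℝ) :
    |latticeKernel m t| ≤ (m.1 : ℝ) ^ 2 + (m.2 : ℝ) ^ 2 := by
  unfold latticeKernel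
  have h := one_sub_cos_le m t
  have h0 := Real.cos_le_one (t.1 * m.1 + t.2 * m.2)
  have hs : 0 ≤ 4 * Real.sin (t.1 / 2) ^ 2 + 4 * Real.sin (t.2 / 2) ^ 2 := by positivity
  rw [abs_div, abs_of_nonneg hs]
  refine div_le_of_le_mul₀ hs (by positivity) ?_
  rw [abs_of_nonpos (by linarith)]
  linarith

/-- Geometric summation of the Fourier symbol against `cos - 1`. -/
lemma cos_sub_one_mul_geom_sum (m : ℤ × ℤ) (t : ℝ × ℝ) (N : ℕ) :
    (Real.cos (t.1 * m.1 + t.2 * m.2) - 1) * ∑ k ∈ Finset.range N, avgSymbol t ^ k =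
      4 * (latticeKernel m t * (1 - avgSymbol t ^ N)) := by
  have h := one_sub_cos_le m t
  have h0 := Real.cos_le_one (t.1 * m.1 + t.2 * m.2)
  unfold latticeKernel
  rw [sin_half_sq_add_eq] at h ⊢
  by_cases h1 : avgSymbol t = 1
  · have : Real.cos (t.1 * m.1 + t.2 * m.2) - 1 = 0 := by
      rw [h1] at h; linarith
    simp [this]
  · have h2 : 1 - avgSymbol t ≠ 0 := sub_ne_zero.mpr (Ne.symm h1)
    rw [← mul_neg_geom_sum]
    field_simp

lemma continuous_avgSymbol : Continuous avgSymbol := by unfold avgSymbol; fun_prop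

lemma measurable_latticeKernel (m : ℤ × ℤ) : Measurable (latticeKernel m) := by
  unfold latticeKernel; fun_prop

lemma isCompact_brillouin : IsCompact brillouin := isCompact_Icc.prod isCompact_Icc

lemma volume_brillouin_ne_top : volume brillouin ≠ ⊤ := isCompact_brillouin.measure_lt_top.ne

instance : IsFiniteMeasure (volume.restrict brillouin) :=
  ⟨by simpa using volume_brillouin_ne_top.lt_top⟩

lemma Continuous.integrableOn_brillouin {g : ℝ × ℝ → ℝ} (hg : Continuous g) :
    IntegrableOn g brillouin :=
  hg.continuousOn.integrableOn_compact isCompact_brillouin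

lemma integrable_walkKernel (k : ℕ) (m : ℤ × ℤ) :
    IntegrableOn (fun t : ℝ × ℝ => Real.cos (t.1 * (m.1 : ℝ) + t.2 * (m.2 : ℝ)) * avgSymbol t ^ k)
      brillouin := by
  refine Continuous.integrableOn_brillouin ?_
  have := continuous_avgSymbol
  fun_prop

lemma latAvg_walkKernel (k : ℕ) (m : ℤ × ℤ) :
    latAvg (walkKernel k) m = walkKernel (k + 1) m := by
  have e : ∀ t : ℝ × ℝ, Real.cos (t.1 * (m.1 : ℝ) + t.2 * (m.2 : ℝ)) * avgSymbol t ^ (k + 1) =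
      (Real.cos (t.1 * ((m + (1, 0)).1 : ℤ) + t.2 * ((m + (1, 0)).2 : ℤ)) * avgSymbol t ^ k
        + Real.cos (t.1 * ((m - (1, 0)).1 : ℤ) + t.2 * ((m - (1, 0)).2 : ℤ)) * avgSymbol t ^ k
        + Real.cos (t.1 * ((m + (0, 1)).1 : ℤ) + t.2 * ((m + (0, 1)).2 : ℤ)) * avgSymbol t ^ k
        + Real.cos (t.1 * ((m - (0, 1)).1 : ℤ) + t.2 * ((m - (0, 1)).2 : ℤ)) * avgSymbol t ^ k)
        / 4 := by
    intro t
    have h1 : t.1 * (((m.1 + 1 : ℤ)) : ℝ) + t.2 * m.2 = (t.1 * m.1 + t.2 * m.2) + t.1 := by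
      push_cast; ring
    have h2 : t.1 * (((m.1 - 1 : ℤ)) : ℝ) + t.2 * m.2 = (t.1 * m.1 + t.2 * m.2) - t.1 := by
      push_cast; ring
    have h3 : t.1 * m.1 + t.2 * (((m.2 + 1 : ℤ)) : ℝ) = (t.1 * m.1 + t.2 * m.2) + t.2 := by
      push_cast; ring
    have h4 : t.1 * m.1 + t.2 * (((m.2 - 1 : ℤ)) : ℝ) = (t.1 * m.1 + t.2 * m.2) - t.2 := by
      push_cast; ring
    simp only [Prod.fst_add, Prod.snd_add, Prod.fst_sub, Prod.snd_sub, add_zero, sub_zero]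
    rw [h1, h2, h3, h4, pow_succ]
    generalize avgSymbol t ^ k = c
    generalize t.1 * (m.1 : ℝ) + t.2 * m.2 = x
    rw [Real.cos_add, Real.cos_sub, Real.cos_add, Real.cos_sub]
    unfold avgSymbol
    ring
  unfold latAvg walkKernel
  simp_rw [e]
  rw [integral_div, integral_add, integral_add, integral_add]
  · ring
  all_goals
    first
    | exact integrable_walkKernel k _
    | exact (integrable_walkKernel k _).add (integrable_walkKernel k _)
    | exact ((integrable_walkKernel k _).add (integrable_walkKernel k _)).add
        (integrable_walkKernel k _)

lemma setIntegral_cos_int_mul (n : ℤ) :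
    ∫ x in Set.Icc (-Real.pi) Real.pi, Real.cos (x * n) = if n = 0 then 2 * Real.pi else 0 := by
  rw [integral_Icc_eq_integral_Ioc, ← intervalIntegral.integral_of_le (by linarith [Real.pi_pos])]
  split_ifs with h
  · simp [h]; ring
  · have hn : (n : ℝ) ≠ 0 := by exact_mod_cast h
    rw [intervalIntegral.integral_comp_mul_right _ hn]
    simp [mul_comm Real.pi, Real.sin_int_mul_pi]

lemma setIntegral_sin_int_mul (n : ℤ) :
    ∫ x in Set.Icc (-Real.pi) Real.pi, Real.sin (x * n) = 0 := by
  rw [integral_Icc_eq_integral_Ioc, ← intervalIntegral.integral_of_le (by linarith [Real.pi_pos])]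
  by_cases h : n = 0
  · simp [h]
  · have hn : (n : ℝ) ≠ 0 := by exact_mod_cast h
    rw [intervalIntegral.integral_comp_mul_right _ hn]
    simp

lemma walkKernel_zero (m : ℤ × ℤ) : walkKernel 0 m = if m = 0 then 1 else 0 := by
  unfold walkKernel
  simp only [pow_zero, mul_one, Real.cos_add]
  rw [integral_sub]
  rotate_left
  · exact Continuous.integrableOn_brillouin (by fun_prop)
  · exact Continuous.integrableOn_brillouin (by fun_prop)
  unfold brillouin
  rw [Measure.volume_eq_prod, setIntegral_prod_mul (fun x : ℝ => Real.cos (x * m.1))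
      (fun x : ℝ => Real.cos (x * m.2)),
    setIntegral_prod_mul (fun x : ℝ => Real.sin (x * m.1)) (fun x : ℝ => Real.sin (x * m.2)),
    setIntegral_cos_int_mul, setIntegral_cos_int_mul, setIntegral_sin_int_mul]
  have := Real.pi_pos
  rcases m with ⟨a, b⟩
  by_cases ha : a = 0 <;> by_cases hb : b = 0 <;> simp [ha, hb, Prod.ext_iff]
  field_simp

lemma walkKernel_nonneg (k : ℕ) (m : ℤ × ℤ) : 0 ≤ walkKernel k m := by
  induction k generalizing m with
  | zero => rw [walkKernel_zero]; split_ifs <;> norm_num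
  | succ k ih =>
    rw [← latAvg_walkKernel]
    unfold latAvg
    linarith [ih (m + (1, 0)), ih (m - (1, 0)), ih (m + (0, 1)), ih (m - (0, 1))]

lemma ae_tendsto_avgSymbol_pow :
    ∀ᵐ t ∂(volume.restrict brillouin), Tendsto (fun N => avgSymbol t ^ N) atTop (nhds 0) := by
  have h : ∀ᵐ x : ℝ, Real.sin x ≠ 0 := by
    have : {x : ℝ | Real.sin x = 0}.Countable := by
      refine (Set.countable_range (fun n : ℤ => (n : ℝ) * Real.pi)).mono ?_
      intro x hx
      exact Real.sin_eq_zero_iff.mp hx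
    exact this.ae_notMem volume
  refine ae_restrict_of_ae ?_
  have h' : ∀ᵐ t : ℝ × ℝ, Real.sin t.1 ≠ 0 :=
    Measure.quasiMeasurePreserving_fst.ae h
  filter_upwards [h'] with t ht
  refine tendsto_pow_atTop_nhds_zero_of_abs_lt_one ?_
  have h1 : Real.cos t.1 ^ 2 < 1 := by
    have := Real.sin_sq_add_cos_sq t.1
    have : 0 < Real.sin t.1 ^ 2 := by positivity
    linarith
  have h2 := abs_lt.mp ((sq_lt_one_iff_abs_lt_one _).mp h1)
  unfold avgSymbol
  rw [abs_lt]
  constructor <;> linarith [Real.cos_le_one t.2, Real.neg_one_le_cos t.2, h2.1, h2.2]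

lemma tendsto_walkKernel (m : ℤ × ℤ) : Tendsto (fun N => walkKernel N m) atTop (nhds 0) := by
  unfold walkKernel
  rw [show (0 : ℝ) = 1 / (2 * Real.pi) ^ 2 * ∫ t in brillouin, (0 : ℝ) by simp]
  refine Tendsto.const_mul _ ?_
  refine tendsto_integral_of_dominated_convergence (fun _ => (1 : ℝ))
    (fun N => (integrable_walkKernel N m).aestronglyMeasurable) (integrable_const _) ?_ ?_
  · refine fun N => Eventually.of_forall fun t => ?_
    rw [Real.norm_eq_abs, abs_mul, abs_pow]
    exact mul_le_one₀ (Real.abs_cos_le_one _) (by positivity)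
      (pow_le_one₀ (abs_nonneg _) (abs_avgSymbol_le_one t))
  · filter_upwards [ae_tendsto_avgSymbol_pow] with t ht
    simpa using ht.const_mul (Real.cos (t.1 * (m.1 : ℝ) + t.2 * (m.2 : ℝ)))

/-- The potential kernel of the walk is the lattice fundamental solution. -/
lemma tendsto_sum_walkKernel_sub (m : ℤ × ℤ) :
    Tendsto (fun N => (∑ k ∈ Finset.range N, (walkKernel k m - walkKernel k 0)) / 4) atTop
      (nhds (phi m)) := by
  have e : ∀ N, (∑ k ∈ Finset.range N, (walkKernel k m - walkKernel k 0)) / 4 =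
      1 / (2 * Real.pi) ^ 2 * ∫ t in brillouin, latticeKernel m t * (1 - avgSymbol t ^ N) := by
    intro N
    have h : ∀ k, walkKernel k m - walkKernel k 0 = 1 / (2 * Real.pi) ^ 2 *
        ∫ t in brillouin, (Real.cos (t.1 * (m.1 : ℝ) + t.2 * (m.2 : ℝ)) - 1) * avgSymbol t ^ k := by
      intro k
      unfold walkKernel
      rw [← mul_sub, ← integral_sub (integrable_walkKernel k m) (integrable_walkKernel k 0)]
      simp [sub_mul]
    have hc := continuous_avgSymbol
    simp_rw [h]
    rw [← Finset.mul_sum, ← integral_finsetSum _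
      (fun k _ => Continuous.integrableOn_brillouin (by fun_prop))]
    simp_rw [← Finset.mul_sum, cos_sub_one_mul_geom_sum]
    rw [integral_const_mul]
    ring
  simp_rw [e]
  unfold phi
  refine Tendsto.const_mul _ ?_
  have hm := continuous_avgSymbol.measurable
  have hk := measurable_latticeKernel m
  refine tendsto_integral_of_dominated_convergence
    (fun _ => ((m.1 : ℝ) ^ 2 + (m.2 : ℝ) ^ 2) * 2) (fun N => ?_) (integrable_const _) ?_ ?_
  · exact Measurable.aestronglyMeasurable (by fun_prop)
  · refine fun N => Eventually.of_forall fun t => ?_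
    rw [Real.norm_eq_abs, abs_mul]
    refine mul_le_mul (abs_latticeKernel_le m t) ?_ (abs_nonneg _) (by positivity)
    refine (abs_sub _ _).trans ?_
    rw [abs_one, abs_pow]
    linarith [pow_le_one₀ (n := N) (abs_nonneg _) (abs_avgSymbol_le_one t)]
  · filter_upwards [ae_tendsto_avgSymbol_pow] with t ht
    simpa using (ht.const_sub 1).const_mul (latticeKernel m t)

/-- Lower bound for the return probability at even times. -/
lemma le_walkKernel_even (k : ℕ) :
    1 / (2 * Real.pi) ^ 2 * (1 / ((k : ℝ) + 1)) ≤ walkKernel (2 * (k + 1)) 0 := by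
  unfold walkKernel
  refine mul_le_mul_of_nonneg_left ?_ (by positivity)
  have hk : (0 : ℝ) < (k : ℝ) + 1 := by positivity
  set r : ℝ := Real.sqrt (1 / (2 * (k + 1))) with hr
  have hr2 : r ^ 2 = 1 / (2 * (k + 1)) := Real.sq_sqrt (by positivity)
  have hr0 : 0 ≤ r := Real.sqrt_nonneg _
  have hr1 : r ≤ Real.pi := by
    have : r ≤ 1 := by
      rw [hr, Real.sqrt_le_iff, one_pow, div_le_one (by positivity)]
      refine ⟨zero_le_one, ?_⟩
      have : (0 : ℝ) ≤ k := k.cast_nonneg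
      linarith
    linarith [Real.pi_gt_three]
  have hsub : Set.Icc (-r) r ×ˢ Set.Icc (-r) r ⊆ brillouin :=
    Set.prod_mono (Set.Icc_subset_Icc (by linarith) hr1) (Set.Icc_subset_Icc (by linarith) hr1)
  have hpos : ∀ t : ℝ × ℝ, 0 ≤ avgSymbol t ^ (2 * (k + 1)) := fun t => by
    rw [pow_mul]; positivity
  have hint := integrable_walkKernel (2 * (k + 1)) 0
  simp only [Prod.fst_zero, Prod.snd_zero, Int.cast_zero, mul_zero, add_zero, Real.cos_zero,
    one_mul] at hint ⊢
  have hmeas : MeasurableSet (Set.Icc (-r) r ×ˢ Set.Icc (-r) r) :=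
    measurableSet_Icc.prod measurableSet_Icc
  calc 1 / ((k : ℝ) + 1) = ∫ t in Set.Icc (-r) r ×ˢ Set.Icc (-r) r, (1 / 2 : ℝ) := by
        rw [setIntegral_const, Measure.volume_eq_prod, measureReal_prod_prod,
          Real.volume_real_Icc_of_le (by linarith), smul_eq_mul]
        have : (r - -r) * (r - -r) = 4 * r ^ 2 := by ring
        rw [this, hr2]
        field_simp
        norm_num
    _ ≤ ∫ t in Set.Icc (-r) r ×ˢ Set.Icc (-r) r, avgSymbol t ^ (2 * (k + 1)) := by
        refine setIntegral_mono_on ?_ (hint.mono_set hsub) hmeas ?_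
        · exact (continuous_const.integrableOn_brillouin).mono_set hsub
        · rintro t ⟨h1, h2⟩
          have hq : ∀ x ∈ Set.Icc (-r) r, 1 - 1 / (4 * (k + 1)) ≤ Real.cos x := by
            intro x hx
            have h3 := Real.one_sub_sq_div_two_le_cos (x := x)
            have h4 : x ^ 2 ≤ r ^ 2 := sq_le_sq' hx.1 hx.2
            rw [hr2] at h4
            have : (1 : ℝ) / (4 * (k + 1)) = 1 / (2 * (k + 1)) / 2 := by field_simp; norm_num
            linarith
          have h5 : 1 + -(1 / (4 * ((k : ℝ) + 1))) ≤ avgSymbol t := by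
            unfold avgSymbol; linarith [hq _ h1, hq _ h2]
          have h6 : 1 / (4 * ((k : ℝ) + 1)) ≤ 1 := by
            rw [div_le_one (by positivity)]
            have : (0 : ℝ) ≤ k := k.cast_nonneg
            linarith
          have h7 := one_add_mul_le_pow (a := -(1 / (4 * ((k : ℝ) + 1)))) (by linarith)
            (2 * (k + 1))
          have h8 := pow_le_pow_left₀ (by linarith) h5 (2 * (k + 1))
          refine le_trans (le_of_eq ?_) (h7.trans h8)
          push_cast
          field_simp
          norm_num
    _ ≤ ∫ t in brillouin, avgSymbol t ^ (2 * (k + 1)) :=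
        setIntegral_mono_set hint (Eventually.of_forall hpos) hsub.eventuallyLE

/-- Recurrence of the simple random walk on `ℤ²`. -/
lemma not_summable_walkKernel_zero : ¬ Summable (fun k => walkKernel k 0) := by
  intro h
  have h1 : Summable (fun k : ℕ => walkKernel (2 * (k + 1)) 0) :=
    h.comp_injective (i := fun k : ℕ => 2 * (k + 1)) (fun a b hab => by
      simpa using hab)
  have h2 : Summable (fun k : ℕ => 1 / (2 * Real.pi) ^ 2 * (1 / ((k : ℝ) + 1))) :=
    Summable.of_nonneg_of_le (fun k => by positivity) le_walkKernel_even h1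
  have h3 : Summable (fun k : ℕ => 1 / ((k : ℝ) + 1)) :=
    (summable_mul_left_iff (by have := Real.pi_pos; positivity)).mp h2
  refine Real.not_summable_one_div_natCast ?_
  rw [← summable_nat_add_iff 1]
  simpa using h3

lemma tendsto_sum_walkKernel_zero :
    Tendsto (fun N => ∑ k ∈ Finset.range N, walkKernel k 0) atTop atTop :=
  (not_summable_iff_tendsto_nat_atTop_of_nonneg (fun k => walkKernel_nonneg k 0)).mp
    not_summable_walkKernel_zero

lemma latAvg_iterate_eq_sum {f : ℤ × ℤ → ℝ} {s : Finset (ℤ × ℤ)} (hf : ∀ n ∉ s, f n = 0)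
    (k : ℕ) (m : ℤ × ℤ) : latAvg^[k] f m = ∑ n ∈ s, walkKernel k (m - n) * f n := by
  induction k generalizing m with
  | zero =>
    simp only [Function.iterate_zero, id_eq, walkKernel_zero, sub_eq_zero, ite_mul, one_mul,
      zero_mul, Finset.sum_ite_eq]
    split_ifs with h
    · rfl
    · exact hf m h
  | succ k ih =>
    rw [Function.iterate_succ_apply', latAvg]
    simp only [ih, ← Finset.sum_add_distrib, Finset.sum_div, ← latAvg_walkKernel]
    refine Finset.sum_congr rfl fun n _ => ?_
    unfold latAvg
    rw [add_sub_right_comm, add_sub_right_comm m (0, 1) n, sub_right_comm m (1, 0) n,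
      sub_right_comm m (0, 1) n]
    ring

lemma latAvg_add (u v : ℤ × ℤ → ℝ) : latAvg (u + v) = latAvg u + latAvg v := by
  funext m; simp only [latAvg, Pi.add_apply]; ring

lemma latAvg_sub (u v : ℤ × ℤ → ℝ) : latAvg (u - v) = latAvg u - latAvg v := by
  funext m; simp only [latAvg, Pi.sub_apply]; ring

lemma latAvg_iterate_add (k : ℕ) (u v : ℤ × ℤ → ℝ) :
    latAvg^[k] (u + v) = latAvg^[k] u + latAvg^[k] v := by
  induction k generalizing u v with
  | zero => rfl
  | succ k ih => simp only [Function.iterate_succ_apply, latAvg_add, ih]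

lemma latAvg_iterate_sub (k : ℕ) (u v : ℤ × ℤ → ℝ) :
    latAvg^[k] (u - v) = latAvg^[k] u - latAvg^[k] v := by
  induction k generalizing u v with
  | zero => rfl
  | succ k ih => simp only [Function.iterate_succ_apply, latAvg_sub, ih]

lemma abs_latAvg_iterate_le {u : ℤ × ℤ → ℝ} {c : ℝ} (hu : ∀ m, |u m| ≤ c) (k : ℕ) (m : ℤ × ℤ) :
    |latAvg^[k] u m| ≤ c := by
  induction k generalizing m with
  | zero => exact hu m
  | succ k ih =>
    rw [Function.iterate_succ_apply', latAvg]
    have h1 := abs_le.mp (ih (m + (1, 0)))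
    have h2 := abs_le.mp (ih (m - (1, 0)))
    have h3 := abs_le.mp (ih (m + (0, 1)))
    have h4 := abs_le.mp (ih (m - (0, 1)))
    rw [abs_le]
    constructor <;> linarith [h1.1, h1.2, h2.1, h2.2, h3.1, h3.2, h4.1, h4.2]

lemma finite_setOf_latNorm_lt (R : ℝ) : {m : ℤ × ℤ | latNorm m < R}.Finite := by
  have hb : ∀ a b : ℤ, latNorm (a, b) < R → |a| ≤ ⌈R⌉ ∧ |b| ≤ ⌈R⌉ := by
    intro a b h
    have ha : |(a : ℝ)| ≤ latNorm (a, b) := Real.abs_le_sqrt (by simp; positivity)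
    have hb : |(b : ℝ)| ≤ latNorm (a, b) := Real.abs_le_sqrt (by simp; positivity)
    have hR := Int.le_ceil R
    constructor
    · have : |(a : ℝ)| ≤ ⌈R⌉ := by linarith
      exact_mod_cast this
    · have : |(b : ℝ)| ≤ ⌈R⌉ := by linarith
      exact_mod_cast this
  refine ((Set.finite_Icc (-⌈R⌉) ⌈R⌉).prod (Set.finite_Icc (-⌈R⌉) ⌈R⌉)).subset ?_
  rintro ⟨a, b⟩ h
  exact ⟨abs_le.mp (hb a b h).1, abs_le.mp (hb a b h).2⟩

lemma tendsto_latAvg_iterate {w : ℤ × ℤ → ℝ}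
    (hw : Tendsto w (comap latNorm atTop) (nhds 0)) (m : ℤ × ℤ) :
    Tendsto (fun N => latAvg^[N] w m) atTop (nhds 0) := by
  classical
  rw [Metric.tendsto_atTop]
  intro ε hε
  have h1 : ∀ᶠ n in comap latNorm atTop, |w n| < ε / 2 := by
    simpa [Real.dist_eq] using (Metric.tendsto_nhds.mp hw) (ε / 2) (by positivity)
  obtain ⟨R, hR⟩ := eventually_atTop.mp (eventually_comap.mp h1)
  set s : Finset (ℤ × ℤ) := (finite_setOf_latNorm_lt R).toFinset with hs
  have hmem : ∀ n, n ∈ s ↔ latNorm n < R := fun n => by simp [hs]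
  set w₁ : ℤ × ℤ → ℝ := fun n => if n ∈ s then w n else 0 with hw₁
  have h2 : ∀ n, |(w - w₁) n| ≤ ε / 2 := by
    intro n
    by_cases hn : n ∈ s
    · simp only [Pi.sub_apply, hw₁, hn, if_true, sub_self, abs_zero]; positivity
    · simp only [Pi.sub_apply, hw₁, hn, if_false, sub_zero]
      exact (hR (latNorm n) (not_lt.mp (fun h => hn ((hmem n).mpr h))) n rfl).le
  have h3 : Tendsto (fun N => latAvg^[N] w₁ m) atTop (nhds 0) := by
    simp_rw [fun N => latAvg_iterate_eq_sum (f := w₁) (s := s)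
      (fun n hn => by simp [hw₁, hn]) N m]
    rw [show (0 : ℝ) = ∑ n ∈ s, 0 * w₁ n by simp]
    exact tendsto_finsetSum _ fun n _ => (tendsto_walkKernel (m - n)).mul_const _
  obtain ⟨N₀, hN₀⟩ := Metric.tendsto_atTop.mp h3 (ε / 2) (by positivity)
  refine ⟨N₀, fun N hN => ?_⟩
  have h4 := hN₀ N hN
  have h5 := abs_latAvg_iterate_le h2 N m
  have h6 : latAvg^[N] w m = latAvg^[N] (w - w₁) m + latAvg^[N] w₁ m := by
    rw [← Pi.add_apply, ← latAvg_iterate_add, sub_add_cancel]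
  rw [Real.dist_eq, sub_zero] at h4 ⊢
  rw [h6]
  linarith [abs_add_le (latAvg^[N] (w - w₁) m) (latAvg^[N] w₁ m)]

lemma sub_latAvg_iterate (w : ℤ × ℤ → ℝ) (N : ℕ) (m : ℤ × ℤ) :
    w m - latAvg^[N] w m = (∑ k ∈ Finset.range N, latAvg^[k] (w - latAvg w) m) := by
  induction N with
  | zero => simp
  | succ N ih =>
    rw [Finset.sum_range_succ, ← ih, latAvg_iterate_sub, Pi.sub_apply,
      Function.iterate_succ_apply]
    ring

/-- A decaying function with finitely supported discrete Laplacian is recovered from it by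
convolution with the fundamental solution. -/
lemma eq_sum_phi_mul_discLap {w : ℤ × ℤ → ℝ}
    (hw : Tendsto w (comap latNorm atTop) (nhds 0)) {s : Finset (ℤ × ℤ)}
    (hs : ∀ n ∉ s, discLap w n = 0) (m : ℤ × ℤ) :
    w m = ∑ n ∈ s, phi (m - n) * discLap w n := by
  set f := discLap w with hf
  have hsub : ∀ n, (w - latAvg w) n = f n / 4 := fun n => by
    rw [hf, discLap_eq_sub_latAvg, Pi.sub_apply]; ring
  set g : ℕ → ℝ := fun N => ∑ k ∈ Finset.range N, walkKernel k 0 with hg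
  set H : ℤ × ℤ → ℕ → ℝ := fun n N =>
    (∑ k ∈ Finset.range N, (walkKernel k n - walkKernel k 0)) / 4 with hH
  have key : ∀ N, w m - latAvg^[N] w m - ∑ n ∈ s, H (m - n) N * f n =
      g N * ((∑ n ∈ s, f n) / 4) := by
    intro N
    rw [sub_latAvg_iterate, Finset.sum_congr rfl fun k _ => latAvg_iterate_eq_sum (s := s)
      (fun n hn => by rw [hsub, hs n hn, zero_div]) k m, Finset.sum_comm, ← Finset.sum_sub_distrib,
      Finset.sum_div, Finset.mul_sum]
    refine Finset.sum_congr rfl fun n _ => ?_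
    simp only [hH, hg, hsub, Finset.sum_sub_distrib, ← Finset.sum_mul]
    ring
  have hlim : Tendsto (fun N => g N * ((∑ n ∈ s, f n) / 4)) atTop
      (nhds (w m - 0 - ∑ n ∈ s, phi (m - n) * f n)) := by
    simp_rw [← key]
    exact ((tendsto_latAvg_iterate hw m).const_sub (w m)).sub
      (tendsto_finsetSum _ fun n _ => (tendsto_sum_walkKernel_sub (m - n)).mul_const _)
  have hzero : (∑ n ∈ s, f n) / 4 = 0 := by
    by_contra hne
    have h := hlim.mul_const ((∑ n ∈ s, f n) / 4)⁻¹
    simp_rw [mul_inv_cancel_right₀ hne] at h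
    exact not_tendsto_nhds_of_tendsto_atTop tendsto_sum_walkKernel_zero _ h
  rw [hzero] at hlim
  simp only [mul_zero] at hlim
  linarith [tendsto_nhds_unique tendsto_const_nhds hlim]

lemma latConv_eq_sum {f : ℤ × ℤ → ℝ} {s : Finset (ℤ × ℤ)} (hf : ∀ n ∉ s, f n = 0)
    (m : ℤ × ℤ) : latConv f m = ∑ n ∈ s, phi (m - n) * f n := by
  refine finsum_eq_sum_of_support_subset _ fun n hn => ?_
  by_contra h
  exact hn (by simp [hf n h])

/-- Reduction of a lattice problem with local inclusions to an equation on the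
inclusion set.  `B` is a linear operator whose outputs are supported in a fixed
finite set `Ω_inc`; `v` is discrete harmonic; `w` solves `(A + B)w = −Bv` and
decays at infinity.  Then `μ := Bw` satisfies `μ + B(Sμ) = −B(S(Bv))`, and the
solution `u := v + w` of `(A + B)u = 0` is recovered as `u = v − S(Bv + μ)`. -/
theorem lattice_inclusion_reduction
    (B : ((ℤ × ℤ) → ℝ) →ₗ[ℝ] ((ℤ × ℤ) → ℝ)) (Ωinc : Set (ℤ × ℤ))
    (hΩ : Ωinc.Finite) (hB : ∀ u : (ℤ × ℤ) → ℝ, Function.support (B u) ⊆ Ωinc)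
    (v w : (ℤ × ℤ) → ℝ) (hv : ∀ m : ℤ × ℤ, discLap v m = 0)
    (hw : ∀ m : ℤ × ℤ, discLap w m + B w m = -(B v m))
    (hdecay : Filter.Tendsto w (Filter.comap latNorm Filter.atTop) (nhds 0)) :
    (∀ m : ℤ × ℤ,
      B w m + B (latConv (B w)) m = -(B (latConv (B v)) m)) ∧
    (∀ m : ℤ × ℤ,
      v m + w m = v m - latConv (fun n => B v n + B w n) m) := by
  have hs : ∀ u, ∀ n ∉ hΩ.toFinset, B u n = 0 := fun u n hn => by
    by_contra h
    exact hn (hΩ.mem_toFinset.mpr (hB u h))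
  have hlap : ∀ n, discLap w n = -(B v n + B w n) := fun n => by linarith [hw n]
  have hwm : ∀ m, w m = -(latConv (B v) m + latConv (B w) m) := fun m => by
    rw [eq_sum_phi_mul_discLap hdecay (s := hΩ.toFinset)
        (fun n hn => by rw [hlap, hs v n hn, hs w n hn]; simp) m,
      latConv_eq_sum (hs v), latConv_eq_sum (hs w), ← Finset.sum_add_distrib,
      ← Finset.sum_neg_distrib]
    refine Finset.sum_congr rfl fun n _ => ?_
    rw [hlap]; ring
  refine ⟨fun m => ?_, fun m => ?_⟩
  · have hfun : w = -(latConv (B v) + latConv (B w)) := funext hwm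
    have h := congrFun (congrArg B hfun) m
    rw [map_neg, map_add] at h
    simp only [Pi.neg_apply, Pi.add_apply] at h
    linarith
  · rw [latConv_eq_sum (s := hΩ.toFinset)
      (fun n hn => by rw [hs v n hn, hs w n hn, add_zero]), hwm m, latConv_eq_sum (hs v),
      latConv_eq_sum (hs w)]
    simp only [mul_add, Finset.sum_add_distrib]
    ring
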